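/- Let T : X → X be a bijection and A ⊆ X. Then for every pair of reals a < b, every integer k ≥ 1, every N ∈ ℕ, and every x ∈ X, the upper uniform density s̄*(x, U_{a,b,k,N}) is strictly less than 2/(k(b−a)). -/

import Mathlib

open Filter
open scoped Classical

/-- The frequency of visits of the first `N` points of the forward orbit of `x` to `A`:
`S_N(x,A) = (1/N) · #{0 ≤ i < N : T^i x ∈ A}`. -/
noncomputable def visitFreq {X : Type*} (T : Equiv.Perm X) (A : Set X) (x : X) (N : ℕ) : ℝ :=
  (∑ i ∈ Finset.range N, if (T ^ i) x ∈ A then (1 : ℝ) else 0) / N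

/-- The upper uniform density of a set `I ⊆ ℤ`:
`limsup_{N→∞} sup_{n∈ℤ} (1/N)·|I ∩ [n, n+N−1]|`. -/
noncomputable def upperUniformDensity (I : Set ℤ) : ℝ :=
  limsup (fun N : ℕ =>
    ⨆ n : ℤ, (∑ i ∈ Finset.range N, if n + (i : ℤ) ∈ I then (1 : ℝ) else 0) / N) atTop

/-- The set `U_{a,b,k,N}` of points having `k` upcrossings of `(a,b)` w.r.t. `1_A` up to
time `N`: there are `1 ≤ m_1 < n_1 < m_2 < n_2 < ⋯ < m_k < n_k ≤ N` with
`S_{m_i}(x,A) < a` and `S_{n_i}(x,A) > b` for all `i`. -/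
def upcrossSet {X : Type*} (T : Equiv.Perm X) (A : Set X) (a b : ℝ) (k N : ℕ) : Set X :=
  {x | ∃ m n : Fin k → ℕ,
    (∀ i, 1 ≤ m i) ∧ (∀ i, m i < n i) ∧ (∀ i j : Fin k, i < j → n i < m j) ∧
    (∀ i, n i ≤ N) ∧
    (∀ i, visitFreq T A x (m i) < a) ∧ (∀ i, b < visitFreq T A x (n i))}

/-- The right endpoints of the maximal blocks of consecutive integers in `C`. -/
def blockEnds (C : Finset ℕ) : Finset ℕ := C.filter fun j => j + 1 ∉ C

theorem mem_blockEnds {C : Finset ℕ} {j : ℕ} : j ∈ blockEnds C ↔ j ∈ C ∧ j + 1 ∉ C := by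
  simp [blockEnds]

theorem exists_mem_blockEnds {C : Finset ℕ} {j p : ℕ} (hj : j ∈ C) (hp : p ∉ C) (hjp : j ≤ p) :
    ∃ e ∈ blockEnds C, j ≤ e ∧ e < p := by
  induction p, hjp using Nat.le_induction with
  | base => exact absurd hj hp
  | succ q hq ih =>
    by_cases hqC : q ∈ C
    · exact ⟨q, mem_blockEnds.2 ⟨hqC, hp⟩, hq, q.lt_succ_self⟩
    · obtain ⟨e, he, hje, heq⟩ := ih hqC
      exact ⟨e, he, hje, heq.trans q.lt_succ_self⟩

/-- Each maximal block `[s, t)` of `C` contributes the sum of `f - a` over the block, minus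
`d * (t - i)`. -/
def blockValue (f : ℕ → ℝ) (a d : ℝ) (i : ℕ) (C : Finset ℕ) : ℝ :=
  ∑ j ∈ C, (f j - a) - d * ∑ j ∈ blockEnds C, ((j : ℝ) + 1 - i)

theorem blockValue_erase (f : ℕ → ℝ) (a d : ℝ) {i M : ℕ} {C : Finset ℕ}
    (hC : C ⊆ Finset.Ico i M) :
    blockValue f a d i C + (blockEnds C).card * d
      ≤ blockValue f a d (i + 1) (C.erase i) + max (f i - a) 0 := by
  have hends : blockEnds (C.erase i) = (blockEnds C).erase i := by
    ext j
    simp only [mem_blockEnds, Finset.mem_erase]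
    constructor
    · rintro ⟨⟨h1, h2⟩, h3⟩
      have := Finset.mem_Ico.1 (hC h2)
      exact ⟨h1, h2, fun h => h3 ⟨by omega, h⟩⟩
    · rintro ⟨h1, h2, h3⟩
      exact ⟨⟨h1, h2⟩, fun h => h3 h.2⟩
  have hsum : ∑ j ∈ (blockEnds C).erase i, ((j : ℝ) + 1 - ((i + 1 : ℕ) : ℝ))
      = ∑ j ∈ blockEnds C, ((j : ℝ) + 1 - i) - (blockEnds C).card := by
    rw [Finset.sum_erase _ (by push_cast; ring), Finset.card_eq_sum_ones, Nat.cast_sum,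
      ← Finset.sum_sub_distrib]
    refine Finset.sum_congr rfl fun j _ => ?_
    push_cast
    ring
  have hval : ∑ j ∈ C, (f j - a) ≤ ∑ j ∈ C.erase i, (f j - a) + max (f i - a) 0 := by
    by_cases hi : i ∈ C
    · rw [← Finset.sum_erase_add _ _ hi]
      gcongr
      exact le_max_left _ _
    · rw [Finset.erase_eq_of_notMem hi]
      linarith [le_max_right (f i - a) 0]
  simp only [blockValue, hends, hsum]
  linarith

/-- If only one new block end `q` can appear on passing from `C` to `D`, the value drops by at
most `d * (q + 1 - i)` through the block ends. -/
theorem blockValue_le_of_blockEnds_subset (f : ℕ → ℝ) (a : ℝ) {d : ℝ} (hd : 0 ≤ d) {i q : ℕ}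
    {C D : Finset ℕ} (hC : ∀ j ∈ C, i ≤ j) (hq : i ≤ q)
    (hCD : blockEnds D ⊆ insert q (blockEnds C)) :
    blockValue f a d i C + (∑ j ∈ D, (f j - a) - ∑ j ∈ C, (f j - a)) - d * ((q : ℝ) + 1 - i)
      ≤ blockValue f a d i D := by
  have hpos : ∀ j : ℕ, i ≤ j → (0 : ℝ) ≤ (j : ℝ) + 1 - i := fun j hj => by
    have : (i : ℝ) ≤ j := by exact_mod_cast hj
    linarith
  have hCe : ∀ j ∈ blockEnds C, i ≤ j := fun j hj => hC j (mem_blockEnds.1 hj).1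
  have h1 : ∑ j ∈ blockEnds D, ((j : ℝ) + 1 - i)
      ≤ ∑ j ∈ insert q (blockEnds C), ((j : ℝ) + 1 - i) := by
    refine Finset.sum_le_sum_of_subset_of_nonneg hCD fun j hj _ => hpos j ?_
    rcases Finset.mem_insert.1 hj with rfl | hj
    · exact hq
    · exact hCe j hj
  have h2 : ∑ j ∈ insert q (blockEnds C), ((j : ℝ) + 1 - i)
      ≤ ((q : ℝ) + 1 - i) + ∑ j ∈ blockEnds C, ((j : ℝ) + 1 - i) := by
    by_cases hqC : q ∈ blockEnds C
    · rw [Finset.insert_eq_of_mem hqC]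
      linarith [hpos q hq]
    · rw [Finset.sum_insert hqC]
  have h3 := mul_le_mul_of_nonneg_left (h1.trans h2) hd
  simp only [blockValue]
  linarith

/-- A subset of `[i, M)` of maximal value has at least as many blocks as there are upcrossings
of `(a, b)` by the averages of `f` started at `i`. -/
theorem card_blockEnds_of_upcrossings (f : ℕ → ℝ) {a b : ℝ} (hab : a < b) {i M k : ℕ}
    {C : Finset ℕ} (hC : C ⊆ Finset.Ico i M)
    (hmax : ∀ D ⊆ Finset.Ico i M, blockValue f a (b - a) i D ≤ blockValue f a (b - a) i C)
    (m n : Fin k → ℕ) (hmn : ∀ l, m l < n l) (hnm : ∀ l l' : Fin k, l < l' → n l < m l')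
    (hM : ∀ l, i + n l ≤ M)
    (hm : ∀ l, ∑ j ∈ Finset.Ico i (i + m l), f j < a * m l)
    (hn : ∀ l, b * n l < ∑ j ∈ Finset.Ico i (i + n l), f j) :
    k ≤ (blockEnds C).card := by
  have hd : 0 ≤ b - a := by linarith
  have hCi : ∀ j ∈ C, i ≤ j := fun j hj => (Finset.mem_Ico.1 (hC hj)).1
  have hsplit : ∀ p q : ℕ, p ≤ q → ∑ j ∈ Finset.Ico (i + p) (i + q), (f j - a)
      = (∑ j ∈ Finset.Ico i (i + q), f j - a * q) - (∑ j ∈ Finset.Ico i (i + p), f j - a * p) := by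
    intro p q hpq
    have h := Finset.sum_Ico_consecutive f (Nat.le_add_right i p) (Nat.add_le_add_left hpq i)
    rw [Finset.sum_sub_distrib, ← h, Finset.sum_const, Nat.card_Ico, nsmul_eq_mul,
      show i + q - (i + p) = q - p by omega, Nat.cast_sub hpq]
    ring
  have hend : ∀ l, ((i + n l - 1 : ℕ) : ℝ) + 1 - i = n l := fun l => by
    have := hmn l
    rw [Nat.cast_sub (by omega)]
    push_cast
    ring
  have hmeet : ∀ l, ∃ j ∈ C, i + m l ≤ j ∧ j < i + n l := by
    intro l
    by_contra! hcon
    have hl := hmn l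
    have hdisj : Disjoint C (Finset.Ico (i + m l) (i + n l)) :=
      Finset.disjoint_left.2 fun j hj hj' => by
        have := Finset.mem_Ico.1 hj'
        have := hcon j hj this.1
        omega
    have h := blockValue_le_of_blockEnds_subset f a hd
      (D := C ∪ Finset.Ico (i + m l) (i + n l)) (q := i + n l - 1) hCi (by omega) (by
        intro j hj
        simp only [mem_blockEnds, Finset.mem_union, Finset.mem_Ico, Finset.mem_insert] at hj ⊢
        by_cases hjC : j ∈ C
        · exact Or.inr ⟨hjC, fun h => hj.2 (Or.inl h)⟩
        · have h1 := hj.1.resolve_left hjC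
          have h2 := fun h => hj.2 (Or.inr h)
          left
          omega)
    rw [Finset.sum_union hdisj, hend, hsplit _ _ hl.le] at h
    have h' := hmax (C ∪ Finset.Ico (i + m l) (i + n l)) (Finset.union_subset hC
      (Finset.Ico_subset_Ico (Nat.le_add_right _ _) (hM l)))
    linarith [hm l, hn l]
  have hmiss : ∀ l l' : Fin k, l < l' → ∃ p, p ∉ C ∧ i + n l ≤ p ∧ p < i + m l' := by
    intro l l' hll
    by_contra! hcon
    have hl := hmn l
    have hl' := hnm l l' hll
    have hsub : Finset.Ico (i + n l) (i + m l') ⊆ C := fun p hp => by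
      by_contra hpC
      have hp := Finset.mem_Ico.1 hp
      have := hcon p hpC hp.1
      omega
    have h := blockValue_le_of_blockEnds_subset f a hd
      (D := C \ Finset.Ico (i + n l) (i + m l')) (q := i + n l - 1) hCi (by omega) (by
        intro j hj
        simp only [mem_blockEnds, Finset.mem_sdiff, Finset.mem_Ico, Finset.mem_insert] at hj ⊢
        by_cases hjC : j + 1 ∈ C
        · have h1 := hj.1.2
          have h2 : i + n l ≤ j + 1 ∧ j + 1 < i + m l' := by
            by_contra h
            exact hj.2 ⟨hjC, h⟩
          left
          omega
        · exact Or.inr ⟨hj.1.1, hjC⟩)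
    have hsd := Finset.sum_sdiff (f := fun j => f j - a) hsub
    rw [← hsd, hend, hsplit _ _ hl'.le] at h
    have h' := hmax (C \ Finset.Ico (i + n l) (i + m l')) (Finset.sdiff_subset.trans hC)
    linarith [hm l', hn l]
  have hex : ∀ l, ∃ e ∈ blockEnds C, i + m l ≤ e ∧ ∀ l', l < l' → e < i + m l' := by
    intro l
    obtain ⟨j, hjC, hj1, hj2⟩ := hmeet l
    by_cases hlast : (l : ℕ) + 1 < k
    · obtain ⟨p, hpC, hp1, hp2⟩ := hmiss l ⟨l + 1, hlast⟩ (Fin.lt_def.2 (Nat.lt_succ_self _))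
      obtain ⟨e, he, hje, hep⟩ := exists_mem_blockEnds hjC hpC (by omega)
      refine ⟨e, he, by omega, fun l' hl' => ?_⟩
      rcases eq_or_lt_of_le (show (⟨l + 1, hlast⟩ : Fin k) ≤ l' from hl') with h | h
      · rw [← h]
        omega
      · have := hnm _ _ h
        have := hmn ⟨l + 1, hlast⟩
        omega
    · have hMC : M ∉ C := fun h => (Finset.mem_Ico.1 (hC h)).2.false
      obtain ⟨e, he, hje, -⟩ := exists_mem_blockEnds hjC hMC (Finset.mem_Ico.1 (hC hjC)).2.le
      refine ⟨e, he, by omega, fun l' hl' => ?_⟩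
      have := Fin.lt_def.1 hl'
      have := l'.isLt
      omega
  choose e he hme hem using hex
  have hmono : StrictMono e := fun l l' h => (hem l l' h).trans_le (hme l')
  calc k = (Finset.univ.image e).card := by
        rw [Finset.card_image_of_injective _ hmono.injective, Finset.card_univ, Fintype.card_fin]
    _ ≤ (blockEnds C).card := Finset.card_le_card fun j hj => by
        obtain ⟨l, -, rfl⟩ := Finset.mem_image.1 hj
        exact he l

/-- Bishop's upcrossing inequality for finite sequences. -/
theorem sum_upcrossings_le (f : ℕ → ℝ) {a b : ℝ} (hab : a < b) {M k : ℕ} (I : Finset ℕ)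
    (hI : ∀ i ∈ I, ∃ m n : Fin k → ℕ,
      (∀ l, m l < n l) ∧ (∀ l l' : Fin k, l < l' → n l < m l') ∧ (∀ l, i + n l ≤ M) ∧
      (∀ l, ∑ j ∈ Finset.Ico i (i + m l), f j < a * m l) ∧
      (∀ l, b * n l < ∑ j ∈ Finset.Ico i (i + n l), f j)) (hIM : I ⊆ Finset.range M) :
    k * (b - a) * I.card ≤ ∑ i ∈ Finset.range M, max (f i - a) 0 := by
  have hd : 0 ≤ b - a := by linarith
  have hopt : ∀ i, ∃ C ⊆ Finset.Ico i M, ∀ D ⊆ Finset.Ico i M,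
      blockValue f a (b - a) i D ≤ blockValue f a (b - a) i C := fun i => by
    obtain ⟨C, hC, h⟩ := (Finset.Ico i M).powerset.exists_max_image
      (blockValue f a (b - a) i) ⟨∅, Finset.empty_mem_powerset _⟩
    exact ⟨C, Finset.mem_powerset.1 hC, fun D hD => h D (Finset.mem_powerset.2 hD)⟩
  choose P hP hmax using hopt
  have hempty : ∀ i, blockValue f a (b - a) i ∅ = 0 := fun i => by simp [blockValue, blockEnds]
  have h0 : 0 ≤ blockValue f a (b - a) 0 (P 0) :=
    (hempty 0).symm.le.trans (hmax 0 ∅ (Finset.empty_subset _))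
  have hlast : blockValue f a (b - a) M (P M) = 0 := by
    have := hP M
    rw [Finset.Ico_self, Finset.subset_empty] at this
    rw [this, hempty]
  have hstep : ∀ i, (if i ∈ I then (k : ℝ) * (b - a) else 0)
      ≤ (blockValue f a (b - a) (i + 1) (P (i + 1)) - blockValue f a (b - a) i (P i))
        + max (f i - a) 0 := by
    intro i
    have h1 := blockValue_erase f a (b - a) (hP i)
    have h2 := hmax (i + 1) ((P i).erase i) fun j hj => by
      obtain ⟨hji, hj⟩ := Finset.mem_erase.1 hj
      have := Finset.mem_Ico.1 (hP i hj)
      exact Finset.mem_Ico.2 ⟨by omega, this.2⟩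
    have h3 : (if i ∈ I then (k : ℝ) * (b - a) else 0) ≤ (blockEnds (P i)).card * (b - a) := by
      split_ifs with hi
      · obtain ⟨m, n, hmn, hnm, hM, hm, hn⟩ := hI i hi
        gcongr
        exact card_blockEnds_of_upcrossings f hab (hP i) (hmax i) m n hmn hnm hM hm hn
      · positivity
    linarith
  have hsum := Finset.sum_le_sum fun i (_ : i ∈ Finset.range M) => hstep i
  rw [Finset.sum_add_distrib, Finset.sum_range_sub
    (fun i => blockValue f a (b - a) i (P i)), hlast, ← Finset.sum_filter,
    Finset.filter_mem_eq_inter, Finset.inter_eq_right.2 hIM, Finset.sum_const, nsmul_eq_mul] at hsum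
  linarith

theorem visitFreq_nonneg {X : Type*} (T : Equiv.Perm X) (A : Set X) (x : X) (N : ℕ) :
    0 ≤ visitFreq T A x N :=
  div_nonneg (Finset.sum_nonneg fun i _ => by split_ifs <;> norm_num) N.cast_nonneg

theorem upcrossSet_eq_empty {X : Type*} (T : Equiv.Perm X) (A : Set X) {a : ℝ} (b : ℝ)
    (ha : a ≤ 0) {k : ℕ} (hk : 1 ≤ k) (N : ℕ) : upcrossSet T A a b k N = ∅ := by
  refine Set.eq_empty_of_forall_notMem ?_
  rintro x ⟨m, -, -, -, -, -, hm, -⟩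
  linarith [hm ⟨0, hk⟩, visitFreq_nonneg T A x (m ⟨0, hk⟩)]

theorem visitFreq_zpow_mul {X : Type*} (T : Equiv.Perm X) (A : Set X) (x : X) (s : ℤ) (i : ℕ)
    {m : ℕ} (hm : 0 < m) :
    visitFreq T A ((T ^ (s + (i : ℤ))) x) m * m
      = ∑ j ∈ Finset.Ico i (i + m), if (T ^ (s + (j : ℤ))) x ∈ A then (1 : ℝ) else 0 := by
  have : (m : ℝ) ≠ 0 := by positivity
  rw [visitFreq, div_mul_cancel₀ _ this, Finset.sum_Ico_eq_sum_range, Nat.add_sub_cancel_left]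
  refine Finset.sum_congr rfl fun r _ => ?_
  rw [← zpow_natCast, ← Equiv.Perm.mul_apply, ← zpow_add]
  congr 4
  push_cast
  ring

/-- A bound on the number of visits to `upcrossSet` in every window of length `L`. -/
theorem sum_visits_upcrossSet_le {X : Type*} (T : Equiv.Perm X) (A : Set X) {a b : ℝ}
    (hab : a < b) (k N : ℕ) (x : X) (s : ℤ) (L : ℕ) :
    k * (b - a) * (∑ i ∈ Finset.range L,
        if s + (i : ℤ) ∈ {i : ℤ | (T ^ i) x ∈ upcrossSet T A a b k N} then (1 : ℝ) else 0)
      ≤ (L + N) * max (1 - a) 0 := by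
  rw [Finset.sum_boole]
  refine (sum_upcrossings_le (M := L + N)
    (fun j : ℕ => if (T ^ (s + (j : ℤ))) x ∈ A then (1 : ℝ) else 0) hab _ ?_ ?_).trans ?_
  · intro i hi
    obtain ⟨hiL, m, n, h1, hmn, hnm, hN, hm, hn⟩ := Finset.mem_filter.1 hi
    have hiL := Finset.mem_range.1 hiL
    refine ⟨m, n, hmn, hnm, fun l => by have := hN l; omega, fun l => ?_, fun l => ?_⟩
    · have hpos : 0 < m l := h1 l
      rw [← visitFreq_zpow_mul T A x s i hpos]
      exact mul_lt_mul_of_pos_right (hm l) (by exact_mod_cast hpos)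
    · have hpos : 0 < n l := (Nat.zero_le _).trans_lt (hmn l)
      rw [← visitFreq_zpow_mul T A x s i hpos]
      exact mul_lt_mul_of_pos_right (hn l) (by exact_mod_cast hpos)
  · exact (Finset.filter_subset _ _).trans (Finset.range_subset_range.2 (Nat.le_add_right _ _))
  · refine (Finset.sum_le_card_nsmul _ _ (max (1 - a) 0) fun i _ => ?_).trans ?_
    · refine max_le_max_right _ ?_
      split_ifs <;> linarith
    · simp

theorem upperUniformDensity_le {I : Set ℤ} {c : ℝ}
    (h : ∀ᶠ L : ℕ in atTop, ∀ s : ℤ,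
      (∑ i ∈ Finset.range L, if s + (i : ℤ) ∈ I then (1 : ℝ) else 0) / L ≤ c) :
    upperUniformDensity I ≤ c := by
  refine limsup_le_of_le (isCoboundedUnder_le_of_le atTop (x := 0) fun L => ?_)
    (h.mono fun L hL => ciSup_le hL)
  exact Real.iSup_nonneg fun s =>
    div_nonneg (Finset.sum_nonneg fun i _ => by split_ifs <;> norm_num) L.cast_nonneg

/-- **Finitary Bishop theorem.** For a bijection `T : X → X`, a set `A ⊆ X`, reals `a < b`,
`k ≥ 1` and `N ∈ ℕ`, for every `x ∈ X` the upper uniform density of the visit times of `x`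
to `U_{a,b,k,N}` is less than `2/(k(b−a))`. -/
theorem finitary_bishop {X : Type*} (T : Equiv.Perm X) (A : Set X) (a b : ℝ) (hab : a < b)
    (k : ℕ) (hk : 1 ≤ k) (N : ℕ) (x : X) :
    upperUniformDensity {i : ℤ | (T ^ i) x ∈ upcrossSet T A a b k N}
      < 2 / (k * (b - a)) := by
  have hk' : (0 : ℝ) < k := by exact_mod_cast hk
  have hkd : 0 < k * (b - a) := mul_pos hk' (by linarith)
  rcases le_or_gt a 0 with ha | ha
  · refine lt_of_le_of_lt (upperUniformDensity_le (c := 0) ?_) (by positivity)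
    simp [upcrossSet_eq_empty T A b ha hk N]
  · have hlt : 2 * max (1 - a) 0 < 2 := by
      have : max (1 - a) 0 < 1 := max_lt (by linarith) one_pos
      linarith
    refine lt_of_le_of_lt (upperUniformDensity_le ?_) (div_lt_div_of_pos_right hlt hkd)
    filter_upwards [eventually_ge_atTop (N + 1)] with L hL s
    have hL0 : (0 : ℝ) < L := by exact_mod_cast (Nat.succ_pos N).trans_le hL
    have hNL : (N : ℝ) ≤ L := by exact_mod_cast (Nat.le_succ N).trans hL
    rw [div_le_div_iff₀ hL0 hkd]
    have h := sum_visits_upcrossSet_le T A hab k N x s L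
    have hmul := mul_le_mul_of_nonneg_right hNL (le_max_right (1 - a) 0)
    rw [mul_comm]
    exact h.trans (by linarith)
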